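/- Assume 2 divides n and set α₂ = deg₂(n), β₂ = deg₂(m), γ₂ = deg₂(t), δ₂ = deg₂(r−1). Suppose 1 < δ₂ < α₂. Let x₁, x₂, y₁, y₂ be nonnegative integers with gcd(gcd(r−1,n), t)·y₁ ≡ 0 (mod m) and x₁y₂ − x₂y₁ odd. Define μ(y₁) = 2^{α₂−δ₂−1} if γ₂ ≠ β₂, min{β₂, γ₂} = α₂ − δ₂ and deg₂(y₁) = β₂ − δ₂, and μ(y₁) = 0 otherwise. Then the two congruences x₂·[m]_{r^{y₂}} + t·y₂ − x₁·[t]_{r^{y₁}} − (t·y₁/m)·t ≡ 0 (mod 2^{α₂}) and (r^{y₁}−1)·x₂ + ([r]_{r^{y₁}} − r^{y₂})·x₁ + ((r−1)·y₁/m)·t ≡ 0 (mod 2^{α₂}) hold simultaneously if and only if m·x₂ ≡ t·(x₁ + t·y₁/m − y₂) (mod 2^{α₂}) and y₂ ≡ 1 + t·y₁/m + μ(y₁) (mod 2^{α₂−δ₂}). -/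

import Mathlib

/-- The geometric sum `[k]_s = 1 + s + s^2 + ⋯ + s^(k-1)`, with `[0]_s = 0`. -/
def geomS (s : ℤ) (k : ℕ) : ℤ := ∑ i ∈ Finset.range k, s ^ i

lemma geomS_succ (s : ℤ) (k : ℕ) : geomS s (k+1) = geomS s k + s ^ k := by
  simp [geomS, Finset.sum_range_succ]

lemma geomS_succ' (s : ℤ) (k : ℕ) : geomS s (k+1) = 1 + s * geomS s k := by
  unfold geomS
  rw [Finset.sum_range_succ', Finset.mul_sum]
  simp [pow_succ, mul_comm, add_comm]

lemma pow_eq_geomS (S : ℤ) (k : ℕ) : (1 + S) ^ k = 1 + S * geomS (1 + S) k := by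
  have := geom_sum_mul (1 + S) k
  unfold geomS
  linarith

lemma geomS_add (s : ℤ) (j k : ℕ) : geomS s (j + k) = geomS s j + s ^ j * geomS s k := by
  unfold geomS
  rw [Finset.sum_range_add, Finset.mul_sum]
  simp [pow_add]

lemma geomS_base (S : ℤ) (u : ℕ) :
    ∃ z : ℤ, 2 * geomS (1 + S) u = 2 * u + u * (u - 1) * S + 2 * S ^ 2 * z := by
  induction u with
  | zero => exact ⟨0, by simp [geomS]⟩
  | succ u ih =>
    obtain ⟨z, hz⟩ := ih
    have h1 : ∃ z' : ℤ, geomS (1 + S) u = u + S * z' := by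
      clear hz
      induction u with
      | zero => exact ⟨0, by simp [geomS]⟩
      | succ u ih =>
        obtain ⟨z', hz'⟩ := ih
        refine ⟨u + z' + S * z', ?_⟩
        rw [geomS_succ', hz']; push_cast; ring
    obtain ⟨z', hz'⟩ := h1
    refine ⟨z + z', ?_⟩
    rw [geomS_succ', mul_add, show 2 * ((1 + S) * geomS (1 + S) u) = 2 * geomS (1 + S) u + 2 * S * geomS (1 + S) u by ring, hz, hz']
    push_cast; ring

lemma geomS_base1 (S : ℤ) (u : ℕ) :
    S ∣ geomS (1 + S) u - u := by
      induction u with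
      | zero => exact ⟨0, by simp [geomS]⟩
      | succ u ih =>
        obtain ⟨z', hz'⟩ := ih
        have : geomS (1 + S) u = u + S * z' := by linarith
        refine ⟨u + z' + S * z', ?_⟩
        rw [geomS_succ', this]; push_cast; ring

lemma geomS_main (S : ℤ) (e : ℕ) (he : 2 ≤ e) (hS : 2 ^ e ∣ S) (f : ℕ) : ∀ (u : ℕ), 2 ^ f ∣ u →
    ∃ z : ℤ, 2 * geomS (1 + S) u = 2 * u + u * (u - 1) * S + 2 ^ (f + 2 * e + 1) * z := by
  induction f with
  | zero =>
    intro u _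
    obtain ⟨z, hz⟩ := geomS_base S u
    obtain ⟨s, rfl⟩ := hS
    refine ⟨s ^ 2 * z, ?_⟩
    rw [hz]; ring
  | succ f ih =>
    intro u hu
    obtain ⟨v, hv⟩ := hu
    obtain ⟨u', rfl⟩ : ∃ u', u = u' + u' := ⟨2 ^ f * v, by rw [hv]; ring⟩
    have hu' : 2 ^ f ∣ u' := ⟨v, by rw [pow_succ] at hv; linarith⟩
    obtain ⟨z, hz⟩ := ih u' hu'
    have hG : geomS (1 + S) (u' + u') = geomS (1 + S) u' * (2 + S * geomS (1 + S) u') := by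
      rw [geomS_add, pow_eq_geomS]; ring
    have hb := geomS_base1 S u'
    rw [hG]
    generalize geomS (1 + S) u' = g at *
    have huz : (2 : ℤ) ^ f ∣ u' := by exact_mod_cast hu'
    have h1 : (2 : ℤ) ^ (f + e - 1) ∣ g - u' := by
      have h2 : (2 : ℤ) * 2 ^ (f + e - 1) ∣ 2 * (g - u') := by
        rw [← pow_succ', show f + e - 1 + 1 = f + e by omega]
        have : 2 * (g - u') = u' * S * (u' - 1) + 2 ^ (f + 2 * e + 1) * z := by linarith
        rw [this]
        apply dvd_add
        · rw [pow_add]; exact Dvd.dvd.mul_right (mul_dvd_mul huz hS) _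
        · exact Dvd.dvd.mul_right (pow_dvd_pow _ (by omega)) _
      exact (mul_dvd_mul_iff_left (by norm_num)).1 h2
    have h3 : (2 : ℤ) ^ (f + 1) ∣ g + u' := by
      have : g + u' = (g - u') + 2 * u' := by ring
      rw [this]
      apply dvd_add
      · exact (pow_dvd_pow _ (by omega)).trans h1
      · rw [pow_succ']; exact mul_dvd_mul_left _ huz
    have h4 : (2 : ℤ) ^ (f + e + 1) ∣ (g - u') * (g + u') := by
      rcases Nat.eq_zero_or_pos f with rfl | hf
      · refine dvd_trans ?_ (mul_dvd_mul (hS.trans hb) h3)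
        rw [← pow_add]; exact pow_dvd_pow _ (by omega)
      · refine dvd_trans ?_ (mul_dvd_mul h1 h3)
        rw [← pow_add]; exact pow_dvd_pow _ (by omega)
    obtain ⟨p, hp⟩ := h4
    obtain ⟨s, hs⟩ := hS
    refine ⟨z + s * p, ?_⟩
    have e1 : (2:ℤ) ^ (f + 1 + 2 * e + 1) = 2 * 2 ^ (f + 2 * e + 1) := by ring
    have e2 : (2:ℤ) ^ (f + 1 + 2 * e + 1) * (s * p) = 2 * (2 ^ e * s) * (2 ^ (f + e + 1) * p) := by ring
    rw [mul_add (2 ^ (f + 1 + 2 * e + 1) : ℤ), e2, ← hs, ← hp, e1]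
    push_cast
    linear_combination 2 * hz

/-- exact form for all y -/
lemma geomS_exact (R : ℤ) (d : ℕ) (hd : 2 ≤ d) (ρ : ℤ) (hR : R = 2 ^ d * ρ) (hρ : Odd ρ) (y : ℕ) :
    ∃ o o' : ℤ, Odd o ∧ Odd o' ∧ o * (2 * (geomS (1 + R) y - y)) = R * (y * (y - 1)) * o' := by
  have key : ∀ e : ℕ, ∀ w : ℤ, Odd w → (y : ℤ) * (y - 1) = 2 ^ e * w →
      (∃ z : ℤ, 2 * geomS (1 + R) y = 2 * y + R * (y * (y - 1)) + 2 ^ (e + d + 1) * z) →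
      ∃ o o' : ℤ, Odd o ∧ Odd o' ∧ o * (2 * (geomS (1 + R) y - y)) = R * (y * (y - 1)) * o' := by
    rintro e w hw h1 ⟨z, hz⟩
    refine ⟨w * ρ, w * ρ + 2 * z, hw.mul hρ, (hw.mul hρ).add_even (even_two_mul z), ?_⟩
    have : 2 * (geomS (1 + R) y - y) = R * (y * (y - 1)) + 2 ^ (e + d + 1) * z := by linarith
    rw [this, h1, hR]; ring
  rcases Nat.even_or_odd y with hy | hy
  · rcases Nat.eq_zero_or_pos y with rfl | hpos
    · exact ⟨1, 1, odd_one, odd_one, by simp [geomS]⟩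
    obtain ⟨f, w, hw, hyw⟩ := Nat.exists_eq_two_pow_mul_odd hpos.ne'
    have hf : Odd ((y : ℤ) - 1) := by
      have : Even (y : ℤ) := by exact_mod_cast hy
      exact this.sub_odd odd_one
    obtain ⟨z, hz⟩ := geomS_main R d hd ⟨ρ, hR⟩ f y ⟨w, hyw⟩
    refine key f (w * (y - 1)) (Odd.mul (by exact_mod_cast hw) hf) ?_ ⟨2 ^ d * z, ?_⟩
    · nth_rewrite 1 [hyw]; push_cast; ring
    · rw [hz]; ring
  · obtain ⟨x, rfl⟩ : ∃ x, y = x + 1 := ⟨y - 1, by have := hy.pos; omega⟩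
    rcases Nat.eq_zero_or_pos x with rfl | hpos
    · exact ⟨1, 1, odd_one, odd_one, by simp [geomS]⟩
    obtain ⟨f, w, hw, hyw⟩ := Nat.exists_eq_two_pow_mul_odd hpos.ne'
    obtain ⟨z, hz⟩ := geomS_main R d hd ⟨ρ, hR⟩ f x ⟨w, hyw⟩
    obtain ⟨c, hc⟩ : ∃ c, d = c + 2 := ⟨d - 2, by omega⟩
    have hwz : (x : ℤ) = 2 ^ f * w := by exact_mod_cast hyw
    refine key f (w * (x + 1)) (Odd.mul (by exact_mod_cast hw) (by exact_mod_cast hy)) ?_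
      ⟨2 * 2 ^ c * ρ ^ 2 * w * (x - 1) + (1 + R) * 2 ^ d * z, ?_⟩
    · push_cast; linear_combination (x + 1 : ℤ) * hwz
    · rw [geomS_succ']
      have e1 : (2:ℤ) ^ (f + 2 * d + 1) = 2 ^ (f + d + 1) * 2 ^ d := by ring
      have e2 : (2:ℤ) ^ (f + d + 1) * (2 * 2 ^ c * ρ ^ 2 * w * (x - 1)) = R ^ 2 * (2 ^ f * w) * (x - 1) := by
        rw [hR, hc]; ring
      rw [mul_add (2 ^ (f + d + 1) : ℤ), e2, ← hwz]
      rw [e1] at hz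
      push_cast
      linear_combination (1 + R) * hz

lemma odd_dvd (h : ℕ) (o x : ℤ) (ho : Odd o) : (2:ℤ) ^ h ∣ o * x ↔ (2:ℤ) ^ h ∣ x := by
  have hc : IsCoprime ((2:ℤ) ^ h) o := by
    apply IsCoprime.pow_left
    obtain ⟨j, rfl⟩ := ho
    exact ⟨-j, 1, by ring⟩
  exact ⟨fun hx => hc.dvd_of_dvd_mul_left hx, fun hx => hx.mul_left _⟩

lemma dvd_of_two_mul (a : ℕ) (x : ℤ) (h : (2:ℤ) ^ (a + 1) ∣ 2 * x) : (2:ℤ) ^ a ∣ x := by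
  rw [pow_succ'] at h
  exact (mul_dvd_mul_iff_left (by norm_num)).1 h

lemma pow_split {i j : ℕ} (h : i ≤ j) : ∃ l, (2:ℤ) ^ j = 2 ^ i * 2 ^ l ∧ j = i + l := by
  refine ⟨j - i, ?_, by omega⟩
  rw [← pow_add]; congr 1; omega

lemma cong_one (R : ℤ) (d : ℕ) (hd : 2 ≤ d) (ρ : ℤ) (hR : R = 2 ^ d * ρ) (hρ : Odd ρ)
    (a f u : ℕ) (u' : ℤ) (hu : (u : ℤ) = 2 ^ f * u') (hu' : Odd u') (hda : d < a)
    (ε : ℤ) (hε : (f + d = a ∧ ε = 1) ∨ (a < f + d ∧ ε = 0)) (y : ℕ) :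
    ∃ z, geomS ((1 + R) ^ y) u = u + 2 ^ (a - 1) * (ε * y) + 2 ^ a * z := by
  suffices h : (2:ℤ) ^ a ∣ geomS ((1 + R) ^ y) u - u - 2 ^ (a - 1) * (ε * y) by
    obtain ⟨z, hz⟩ := h
    exact ⟨z, by linarith⟩
  apply dvd_of_two_mul
  obtain ⟨s, hs⟩ := geomS_base1 R y
  rw [pow_eq_geomS]
  generalize geomS (1 + R) y = g at *
  have hfu : 2 ^ f ∣ u := by
    have : ((2 ^ f : ℕ) : ℤ) ∣ (u : ℤ) := ⟨u', by rw [hu]; push_cast; rfl⟩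
    exact_mod_cast this
  obtain ⟨z, hz⟩ := geomS_main (R * g) d hd ⟨ρ * g, by rw [hR]; ring⟩ f u hfu
  have e0 : (2:ℤ) * 2 ^ (a - 1) = 2 ^ a := by
    rw [← pow_succ']; congr 1; omega
  have e1 : 2 * (geomS (1 + R * g) u - u - 2 ^ (a - 1) * (ε * y)) =
      2 ^ (f + d) * (u' * (u - 1) * ρ * g) - 2 ^ a * (ε * y) + 2 ^ (f + 2 * d + 1) * z := by
    have e2 : (2:ℤ) ^ (f + d) * (u' * (u - 1) * ρ * g) = (2 ^ f * u') * (u - 1) * (2 ^ d * ρ * g) := by ring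
    rw [e2, ← hu, ← hR, ← e0]
    linear_combination hz
  rw [e1]
  apply dvd_add
  · rcases hε with ⟨h1, rfl⟩ | ⟨h1, rfl⟩
    · rw [h1, ← mul_sub, pow_succ]
      apply mul_dvd_mul_left
      rw [← even_iff_two_dvd]
      have hue : Even (u : ℤ) := by
        rw [hu]; exact ((even_two.pow_of_ne_zero (by omega)).mul_right _)
      have hRe : Even R := by
        rw [hR]; exact ((even_two.pow_of_ne_zero (by omega)).mul_right _)
      have hg : g = y + R * s := by linarith
      rw [hg]
      rw [← Int.not_even_iff_odd] at hu' hρ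
      simp only [Int.even_sub, Int.even_add, Int.even_mul, one_mul, Int.not_even_one]
      tauto
    · simp only [zero_mul, mul_zero, sub_zero]
      exact Dvd.dvd.mul_right (pow_dvd_pow _ (by omega)) _
  · exact Dvd.dvd.mul_right (pow_dvd_pow _ (by omega)) _

lemma cong_two (Rn : ℕ) (d : ℕ) (hd : 2 ≤ d) (ρ : ℤ) (hR : (Rn : ℤ) = 2 ^ d * ρ) (hρ : Odd ρ)
    (a b h : ℕ) (hah : a = h + d) (hh : 1 ≤ h)
    (ε : ℤ) (hε : (b = h ∧ ε = 1) ∨ (h < b ∧ ε = 0)) (y1 y2 : ℕ) (q x1 x2 k : ℤ)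
    (hq : 2 ^ d * (y1 : ℤ) = 2 ^ b * q) :
    (2:ℤ) ^ a ∣ ((1 + (Rn : ℤ)) ^ y1 - 1) * x2 + (geomS ((1 + (Rn : ℤ)) ^ y1) (Rn + 1) - (1 + (Rn : ℤ)) ^ y2) * x1 + Rn * k
    ↔ (2:ℤ) ^ h ∣ y1 * x2 + k + (1 - geomS (1 + (Rn : ℤ)) y2) * x1 + 2 ^ (h - 1) * (ε * q * (x1 + x2 * (y1 + 1))) := by
  have hb : h ≤ b := by omega
  have hy1 : 2 ^ (b - d) ∣ y1 := by
    rcases le_total b d with hbd | hbd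
    · rw [Nat.sub_eq_zero_of_le hbd]; simp
    · have h1 : (2:ℤ) ^ d * 2 ^ (b - d) ∣ 2 ^ d * (y1 : ℤ) := by
        rw [hq, ← pow_add]; exact Dvd.dvd.mul_right (pow_dvd_pow _ (by omega)) _
      have h2 : (2:ℤ) ^ (b - d) ∣ (y1 : ℤ) := (mul_dvd_mul_iff_left (by positivity)).1 h1
      exact_mod_cast h2
  have hRd : (2:ℤ) ^ d ∣ (Rn : ℤ) := ⟨ρ, hR⟩
  obtain ⟨z1, hz1⟩ := geomS_main (Rn : ℤ) d hd hRd (b - d) y1 hy1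
  have e0 : (2:ℤ) * 2 ^ (h - 1) = 2 ^ h := by
    rw [← pow_succ']; congr 1; omega
  have e0' : (2:ℤ) * 2 ^ (d - 1) = 2 ^ d := by
    rw [← pow_succ']; congr 1; omega
  rw [pow_eq_geomS (Rn : ℤ) y1, pow_eq_geomS (Rn : ℤ) y2]
  generalize geomS (1 + (Rn : ℤ)) y2 = g2 at *
  generalize geomS (1 + (Rn : ℤ)) y1 = g1 at *
  have hyz : (2:ℤ) ^ (b - d) ∣ (y1 : ℤ) := by exact_mod_cast hy1
  have hg1 : (2:ℤ) ^ (b - d) ∣ g1 := by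
    apply dvd_of_two_mul
    rw [hz1]
    have : (2:ℤ) * y1 + y1 * (y1 - 1) * Rn = y1 * (2 + (y1 - 1) * Rn) := by ring
    rw [this]
    apply dvd_add
    · rw [pow_succ]
      apply mul_dvd_mul hyz
      apply dvd_add (dvd_refl _)
      apply Dvd.dvd.mul_left
      exact (dvd_pow_self 2 (by omega)).trans hRd
    · exact Dvd.dvd.mul_right (pow_dvd_pow _ (by omega)) _
  -- expansion of g1
  obtain ⟨A, hA⟩ : (2:ℤ) ^ h ∣ g1 - y1 - 2 ^ (h - 1) * (ε * q * (y1 - 1)) := by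
    apply dvd_of_two_mul
    have : 2 * (g1 - y1 - 2 ^ (h - 1) * (ε * q * (y1 - 1))) =
        (2 ^ b * ρ - 2 ^ h * ε) * (q * (y1 - 1)) + 2 ^ (b - d + 2 * d + 1) * z1 := by
      have e3 : (2 ^ b * ρ - 2 ^ h * ε) * (q * (y1 - 1)) = (2 ^ b * q) * (ρ * (y1 - 1)) - 2 ^ h * (ε * q * (y1 - 1)) := by ring
      rw [e3, ← hq, ← e0]
      rw [hR] at hz1
      linear_combination hz1
    rw [this]
    apply dvd_add
    · apply Dvd.dvd.mul_right
      rcases hε with ⟨rfl, rfl⟩ | ⟨h1, rfl⟩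
      · rw [← mul_sub, pow_succ]
        apply mul_dvd_mul_left
        rw [← even_iff_two_dvd]; exact hρ.sub_odd odd_one
      · rw [mul_zero, sub_zero]
        exact Dvd.dvd.mul_right (pow_dvd_pow _ (by omega)) _
    · exact Dvd.dvd.mul_right (pow_dvd_pow _ (by omega)) _
  obtain ⟨B, hB⟩ : (2:ℤ) ^ h ∣ 2 ^ (d - 1) * ρ * g1 - 2 ^ (h - 1) * (ε * q) := by
    apply dvd_of_two_mul
    have hg : g1 = y1 + 2 ^ (h - 1) * (ε * q * (y1 - 1) + 2 * A) := by
      rw [← e0] at hA; linarith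
    have : 2 * (2 ^ (d - 1) * ρ * g1 - 2 ^ (h - 1) * (ε * q)) =
        (2 ^ b * ρ - 2 ^ h * ε) * q + 2 ^ (d + (h - 1)) * (ρ * (ε * q * (y1 - 1) + 2 * A)) := by
      have e3 : (2 ^ b * ρ - 2 ^ h * ε) * q = (2 ^ b * q) * ρ - 2 ^ h * (ε * q) := by ring
      rw [e3, ← hq, ← e0, ← e0', pow_add, ← e0', hg]
      ring
    rw [this]
    apply dvd_add
    · apply Dvd.dvd.mul_right
      rcases hε with ⟨rfl, rfl⟩ | ⟨h1, rfl⟩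
      · rw [← mul_sub, pow_succ]
        apply mul_dvd_mul_left
        rw [← even_iff_two_dvd]; exact hρ.sub_odd odd_one
      · rw [mul_zero, sub_zero]
        exact Dvd.dvd.mul_right (pow_dvd_pow _ (by omega)) _
    · exact Dvd.dvd.mul_right (pow_dvd_pow _ (by omega)) _
  have hS : (2:ℤ) ^ (d + (b - d)) ∣ Rn * g1 := by
    rw [pow_add]; exact mul_dvd_mul hRd hg1
  obtain ⟨z2, hz2⟩ := geomS_main (Rn * g1 : ℤ) (d + (b - d)) (by omega) hS d Rn (by exact_mod_cast hRd)
  rw [geomS_succ']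
  generalize geomS (1 + Rn * g1) Rn = G at *
  obtain ⟨C, hC⟩ : (2:ℤ) ^ a ∣ (1 + (1 + Rn * g1) * G) - (1 + Rn) + Rn * (2 ^ (d - 1) * ρ * g1) := by
    apply dvd_of_two_mul
    have : 2 * ((1 + (1 + Rn * g1) * G) - (1 + Rn) + Rn * (2 ^ (d - 1) * ρ * g1)) =
        (Rn * (Rn * g1)) * (Rn + 2 + (Rn - 1) * (Rn * g1)) + 2 ^ (d + 2 * (d + (b - d)) + 1) * z2 * (1 + Rn * g1) := by
      have e3 : 2 * (Rn * (2 ^ (d - 1) * ρ * g1)) = Rn * (Rn * g1) := by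
        nth_rewrite 3 [hR]
        rw [← e0']; ring
      linear_combination (1 + Rn * g1) * hz2 + e3
    rw [this]
    have hRe : (2:ℤ) ∣ Rn := (dvd_pow_self 2 (by omega)).trans hRd
    apply dvd_add
    · rw [pow_succ]
      apply mul_dvd_mul
      · refine dvd_trans ?_ (mul_dvd_mul hRd hS)
        rw [← pow_add]; exact pow_dvd_pow _ (by omega)
      · exact dvd_add (dvd_add hRe (dvd_refl _)) ((hRe.mul_right _).mul_left _)
    · exact Dvd.dvd.mul_right (Dvd.dvd.mul_right (pow_dvd_pow _ (by omega)) _) _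
  have hX : (1 + Rn * g1 - 1) * x2 + (1 + (1 + Rn * g1) * G - (1 + Rn * g2)) * x1 + Rn * k =
      2 ^ d * (ρ * (g1 * x2 + (1 - g2) * x1 + k - (2 ^ (d - 1) * ρ * g1) * x1)) + 2 ^ a * (C * x1) := by
    have : 2 ^ d * (ρ * (g1 * x2 + (1 - g2) * x1 + k - (2 ^ (d - 1) * ρ * g1) * x1)) =
      Rn * (g1 * x2 + (1 - g2) * x1 + k - (2 ^ (d - 1) * ρ * g1) * x1) := by rw [hR]; ring
    rw [this]
    linear_combination x1 * hC
  rw [hX, dvd_add_left (Dvd.intro _ rfl), hah, add_comm h d, pow_add, mul_dvd_mul_iff_left (by positivity)]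
  rw [odd_dvd h ρ _ hρ]
  have hY : g1 * x2 + (1 - g2) * x1 + k - (2 ^ (d - 1) * ρ * g1) * x1 =
     (y1 * x2 + k + (1 - g2) * x1 + 2 ^ (h - 1) * (ε * q * (x1 + x2 * (y1 + 1)))) +
      2 ^ h * (A * x2 - B * x1 - ε * q * (x1 + x2)) := by
    rw [← e0] at hA hB ⊢
    linear_combination x2 * hA - x1 * hB
  rw [hY, dvd_add_left (Dvd.intro _ rfl)]

lemma le_of_odd (d b : ℕ) (y q : ℤ) (h : 2 ^ d * y = 2 ^ b * q) (hq : Odd q) : d ≤ b := by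
  by_contra hlt
  push Not at hlt
  obtain ⟨l, hl, hl'⟩ := pow_split hlt
  have : (2:ℤ) ^ b * q = 2 ^ b * (2 * (2 ^ l * y)) := by
    rw [← h, hl, pow_succ]; ring
  have h2 : q = 2 * (2 ^ l * y) := mul_left_cancel₀ (by positivity) this
  rw [← Int.not_even_iff_odd] at hq
  exact hq (h2 ▸ even_two_mul _)

lemma par (b c h : ℕ) (m' t' x2 X : ℤ) (hm : Odd m') (ht : Odd t') (hb : h ≤ b) (hc : h ≤ c)
    (hD : (2:ℤ) ^ (h + 1) ∣ 2 ^ b * m' * x2 - 2 ^ c * t' * X) :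
    (b = h → h < c → Even x2) ∧ (b = h → c = h → Even (x2 - X)) ∧ (c = h → h < b → Even X) := by
  have hm' := hm
  have ht' := ht
  rw [← Int.not_even_iff_odd] at hm' ht'
  refine ⟨?_, ?_, ?_⟩
  · rintro rfl hlt
    obtain ⟨l, hl, -⟩ := pow_split hlt
    have : (2:ℤ) ^ b * m' * x2 - 2 ^ c * t' * X = 2 ^ b * (m' * x2 - 2 * (2 ^ l * t' * X)) := by
      rw [hl, pow_succ]; ring
    rw [this, pow_succ, mul_dvd_mul_iff_left (by positivity), ← even_iff_two_dvd] at hD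
    simp only [Int.even_sub, Int.even_mul, even_two] at hD
    grind
  · rintro rfl rfl
    have : (2:ℤ) ^ c * m' * x2 - 2 ^ c * t' * X = 2 ^ c * (m' * x2 - t' * X) := by ring
    rw [this, pow_succ, mul_dvd_mul_iff_left (by positivity), ← even_iff_two_dvd] at hD
    simp only [Int.even_sub, Int.even_mul] at hD ⊢
    grind
  · rintro rfl hlt
    obtain ⟨l, hl, -⟩ := pow_split hlt
    have : (2:ℤ) ^ b * m' * x2 - 2 ^ c * t' * X = 2 ^ c * (2 * (2 ^ l * m' * x2) - t' * X) := by
      rw [hl, pow_succ]; ring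
    rw [this, pow_succ, mul_dvd_mul_iff_left (by positivity), ← even_iff_two_dvd] at hD
    simp only [Int.even_sub, Int.even_mul, even_two] at hD
    grind

lemma Q_even (b c d h : ℕ) (m' t' x1 x2 y1 y2 k q q' εb εc : ℤ) (hm : Odd m') (ht : Odd t')
    (hεb : (b = h ∧ εb = 1) ∨ (h < b ∧ εb = 0)) (hεc : (c = h ∧ εc = 1) ∨ (h < c ∧ εc = 0))
    (hq' : 2 ^ c * y1 = 2 ^ b * q') (hk : m' * k = t' * q')
    (hodd : ¬ Even (x1 * y2 - x2 * y1))
    (hD : (2:ℤ) ^ (h + 1) ∣ 2 ^ b * m' * x2 - 2 ^ c * t' * (x1 + k - y2))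
    (hw : Even (y2 - 1 - k)) : Even (εb * (x2 * y2) - εc * (x1 * y1)) := by
  obtain ⟨p1, p2, p3⟩ := par b c h m' t' x2 _ hm ht (by omega) (by omega) hD
  have hk' : Even (m' * k) ↔ Even (t' * q') := by rw [hk]
  rw [← Int.not_even_iff_odd] at hm ht
  rcases hεb with ⟨hb, rfl⟩ | ⟨hb, rfl⟩ <;> rcases hεc with ⟨hc, rfl⟩ | ⟨hc, rfl⟩
  · have := p2 hb hc
    have hy : y1 = q' := by
      rw [hb, hc] at hq'
      exact mul_left_cancel₀ (by positivity) hq'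
    subst hy
    simp only [Int.even_sub, Int.even_add, Int.even_mul, Int.not_even_one, one_mul] at *
    grind
  · have := p1 hb hc
    simp only [Int.even_sub, Int.even_mul, Int.not_even_one, one_mul, zero_mul, Even.zero]
    simp [this]
  · have hy : Even y1 := by
      by_contra hy
      rw [Int.not_even_iff_odd] at hy
      have := le_of_odd b c q' y1 hq'.symm hy
      omega
    simp [hy, Int.even_mul]
  · simp

lemma V_par (b c d h : ℕ) (m' t' x1 x2 y1 y2 k q q' εb εc μ : ℤ) (hm : Odd m') (ht : Odd t')
    (hεb : (b = h ∧ εb = 1) ∨ (h < b ∧ εb = 0)) (hεc : (c = h ∧ εc = 1) ∨ (h < c ∧ εc = 0))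
    (hμ : (b ≠ c ∧ min b c = h ∧ Odd q ∧ μ = 1) ∨ (¬ (b ≠ c ∧ min b c = h ∧ Odd q) ∧ μ = 0))
    (hq : 2 ^ d * y1 = 2 ^ b * q)
    (hq' : 2 ^ c * y1 = 2 ^ b * q') (hk : m' * k = t' * q')
    (hodd : ¬ Even (x1 * y2 - x2 * y1))
    (hD : (2:ℤ) ^ (h + 1) ∣ 2 ^ b * m' * x2 - 2 ^ c * t' * (x1 + k - y2))
    (hw : Even (y2 - 1 - k)) :
    Even (q * (εb * (x1 + x2 * (y1 + 1)) + εc * (x1 * (k + 1)))) ↔ Even μ := by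
  by_cases hqo : Even q
  · have : ¬ Odd q := by rwa [Int.not_odd_iff_even]
    have hμ0 : μ = 0 := by tauto
    simp [hμ0, Int.even_mul, hqo]
  obtain ⟨p1, p2, p3⟩ := par b c h m' t' x2 _ hm ht (by omega) (by omega) hD
  have hk' : Even (m' * k) ↔ Even (t' * q') := by rw [hk]
  rw [← Int.not_even_iff_odd] at hm ht
  have hqq : (2:ℤ) ^ d * q' = 2 ^ c * q := by
    have : (2:ℤ) ^ b * (2 ^ d * q') = 2 ^ b * (2 ^ c * q) := by
      linear_combination 2 ^ c * hq - 2 ^ d * hq'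
    exact mul_left_cancel₀ (by positivity) this
  have hdc : d ≤ c := le_of_odd d c q' q hqq (Int.not_even_iff_odd.1 hqo)
  have hdb : d ≤ b := le_of_odd d b y1 q hq (Int.not_even_iff_odd.1 hqo)
  have hqo' := Int.not_even_iff_odd.1 hqo
  have hy1 : d < b → Even y1 := by
    intro hlt
    by_contra hy
    have := le_of_odd b d q y1 hq.symm (Int.not_even_iff_odd.1 hy)
    omega
  have hq1 : d < c → Even q' := by
    intro hlt
    by_contra hy
    have := le_of_odd c d q q' hqq.symm (Int.not_even_iff_odd.1 hy)
    omega
  rcases hεb with ⟨hb, rfl⟩ | ⟨hb, rfl⟩ <;> rcases hεc with ⟨hc, rfl⟩ | ⟨hc, rfl⟩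
  · have := p2 hb hc
    have hy : y1 = q' := by
      rw [hb, hc] at hq'
      exact mul_left_cancel₀ (by positivity) hq'
    subst hy
    have hμ0 : μ = 0 := by
      rcases hμ with h | h
      · omega
      · exact h.2
    rw [hμ0]
    simp only [Int.even_sub, Int.even_add, Int.even_mul, Int.not_even_one, one_mul, Even.zero] at *
    grind
  · have h1 := p1 hb hc
    have hμ0 : μ = 1 := by
      rcases hμ with h | h
      · exact h.2.2.2
      · exact absurd ⟨by omega, by omega, hqo'⟩ h.1
    have h2 := hq1 (by omega)
    rw [hμ0]
    simp only [Int.even_sub, Int.even_add, Int.even_mul, Int.not_even_one, one_mul, zero_mul, Even.zero] at *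
    grind
  · have h1 := p3 hc hb
    have hμ0 : μ = 1 := by
      rcases hμ with h | h
      · exact h.2.2.2
      · exact absurd ⟨by omega, by omega, hqo'⟩ h.1
    have h2 := hy1 (by omega)
    rw [hμ0]
    simp only [Int.even_sub, Int.even_add, Int.even_mul, Int.not_even_one, one_mul, zero_mul, Even.zero] at *
    grind
  · have hμ0 : μ = 0 := by
      rcases hμ with h | h
      · omega
      · exact h.2
    simp [hμ0]

lemma y1x2_eq (a b c d h : ℕ) (hah : a = h + d) (hh : 1 ≤ h) (m' t' x1 x2 y1 y2 k q q' Q z : ℤ)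
    (hq : 2 ^ d * y1 = 2 ^ b * q)
    (hq' : 2 ^ c * y1 = 2 ^ b * q') (hk : m' * k = t' * q')
    (hD : 2 ^ b * m' * x2 - 2 ^ c * t' * (x1 + k - y2) + 2 ^ (a - 1) * Q = 2 ^ a * z) :
    m' * (y1 * x2 - k * (x1 + k - y2)) = 2 ^ (h - 1) * (q * (2 * z - Q)) := by
  have e1 : (2:ℤ) ^ a = 2 ^ d * 2 ^ (h - 1) * 2 := by
    rw [← pow_add, ← pow_succ]; congr 1; omega
  have e2 : (2:ℤ) ^ (a - 1) = 2 ^ d * 2 ^ (h - 1) := by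
    rw [← pow_add]; congr 1; omega
  rw [e1, e2] at hD
  have : (2:ℤ) ^ b * (m' * (y1 * x2 - k * (x1 + k - y2))) = 2 ^ b * (2 ^ (h - 1) * (q * (2 * z - Q))) := by
    linear_combination y1 * hD + (x1 + k - y2) * t' * hq' - 2 ^ b * (x1 + k - y2) * hk + 2 ^ (h - 1) * (2 * z - Q) * hq
  exact mul_left_cancel₀ (by positivity) this

lemma w_even (a b c d h : ℕ) (hah : a = h + d) (hh : 1 ≤ h) (hd : 2 ≤ d)
    (m' t' x1 x2 y1 y2 k q q' εb εc g2 : ℤ) (hm : Odd m')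
    (hεb : (b = h ∧ εb = 1) ∨ (h < b ∧ εb = 0)) (hεc : (c = h ∧ εc = 1) ∨ (h < c ∧ εc = 0))
    (hq : 2 ^ d * y1 = 2 ^ b * q)
    (hq' : 2 ^ c * y1 = 2 ^ b * q') (hk : m' * k = t' * q')
    (hodd : ¬ Even (x1 * y2 - x2 * y1))
    (hg2 : Even (g2 - y2))
    (hD : (2:ℤ) ^ a ∣ 2 ^ b * m' * x2 - 2 ^ c * t' * (x1 + k - y2)
      + 2 ^ (a - 1) * (εb * (x2 * y2) - εc * (x1 * y1)))
    (hX : (2:ℤ) ^ h ∣ y1 * x2 + k + (1 - g2) * x1 + 2 ^ (h - 1) * (εb * q * (x1 + x2 * (y1 + 1)))) :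
    Even (y2 - 1 - k) := by
  obtain ⟨z, hz⟩ := hD
  have hE := y1x2_eq a b c d h hah hh m' t' x1 x2 y1 y2 k q q' _ z hq hq' hk hz
  have hqq : (2:ℤ) ^ d * q' = 2 ^ c * q := by
    have : (2:ℤ) ^ b * (2 ^ d * q') = 2 ^ b * (2 ^ c * q) := by
      linear_combination 2 ^ c * hq - 2 ^ d * hq'
    exact mul_left_cancel₀ (by positivity) this
  have hev : Even ((2:ℤ) ^ (h - 1)) ∨ Even q ∨ (εb = 0 ∧ εc = 0) := by
    by_cases h1 : h = 1
    · right
      by_cases hqo : Even q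
      · exact Or.inl hqo
      · right
        have hdc : d ≤ c := le_of_odd d c q' q hqq (Int.not_even_iff_odd.1 hqo)
        have hdb : d ≤ b := le_of_odd d b y1 q hq (Int.not_even_iff_odd.1 hqo)
        omega
    · left
      exact even_two.pow_of_ne_zero (by omega)
  have hE' : Even (m' * (y1 * x2 - k * (x1 + k - y2))) := by
    rw [hE]
    rcases hev with h1 | h1 | ⟨h1, h2⟩
    · exact h1.mul_right _
    · exact (h1.mul_right _).mul_left _
    · simp [h1, h2, Int.even_mul]
  have hX' := even_iff_two_dvd.2 ((dvd_pow_self (2:ℤ) (by omega : h ≠ 0)).trans hX)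
  have hX2 : Even (2 ^ (h - 1) * (εb * q * (x1 + x2 * (y1 + 1)))) := by
    rcases hev with h1 | h1 | ⟨h1, h2⟩
    · exact h1.mul_right _
    · exact ((h1.mul_left _).mul_right _).mul_left _
    · simp [h1]
  rw [Int.even_add] at hX'
  have hX3 := hX'.2 hX2
  rw [← Int.not_even_iff_odd] at hm
  simp only [Int.even_sub, Int.even_add, Int.even_mul, Int.not_even_one] at hE' hX3 hodd hg2 ⊢
  grind

lemma fin (a b c d h : ℕ) (hah : a = h + d) (hh : 1 ≤ h) (hd : 2 ≤ d)
    (ρ m' t' x1 x2 y1 y2 k q q' εb εc μ g2 o o' : ℤ) (hρ : Odd ρ) (hm : Odd m') (ht : Odd t')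
    (hεb : (b = h ∧ εb = 1) ∨ (h < b ∧ εb = 0)) (hεc : (c = h ∧ εc = 1) ∨ (h < c ∧ εc = 0))
    (hμ : (b ≠ c ∧ min b c = h ∧ Odd q ∧ μ = 1) ∨ (¬ (b ≠ c ∧ min b c = h ∧ Odd q) ∧ μ = 0))
    (hq : 2 ^ d * y1 = 2 ^ b * q)
    (hq' : 2 ^ c * y1 = 2 ^ b * q') (hk : m' * k = t' * q')
    (hodd : ¬ Even (x1 * y2 - x2 * y1))
    (ho : Odd o) (ho' : Odd o')
    (hg2 : o * (2 * (g2 - y2)) = (2 ^ d * ρ) * (y2 * (y2 - 1)) * o')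
    (hD : (2:ℤ) ^ a ∣ 2 ^ b * m' * x2 - 2 ^ c * t' * (x1 + k - y2))
    (hw : Even (y2 - 1 - k)) :
    (2:ℤ) ^ h ∣ y1 * x2 + k + (1 - g2) * x1 + 2 ^ (h - 1) * (εb * q * (x1 + x2 * (y1 + 1))) ↔
    (2:ℤ) ^ h ∣ y2 - (1 + k + 2 ^ (h - 1) * μ) := by
  have hV := V_par b c d h m' t' x1 x2 y1 y2 k q q' εb εc μ hm ht hεb hεc hμ hq hq' hk hodd
    ((pow_dvd_pow _ (by omega)).trans hD) hw
  obtain ⟨z, hz⟩ := hD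
  have hE := y1x2_eq a b c d h hah hh m' t' x1 x2 y1 y2 k q q' 0 z hq hq' hk (by rw [← hz]; ring)
  have hqq : (2:ℤ) ^ d * q' = 2 ^ c * q := by
    have : (2:ℤ) ^ b * (2 ^ d * q') = 2 ^ b * (2 ^ c * q) := by
      linear_combination 2 ^ c * hq - 2 ^ d * hq'
    exact mul_left_cancel₀ (by positivity) this
  have e0 : (2:ℤ) * 2 ^ (h - 1) = 2 ^ h := by
    rw [← pow_succ']; congr 1; omega
  have ed : (2:ℤ) ^ d = 2 * (2 * 2 ^ (d - 2)) := by
    rw [← pow_succ', ← pow_succ']; congr 1; omega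
  obtain ⟨l, hl⟩ : ∃ l : ℤ, 2 ^ c = 2 ^ h * (εc + 2 * l) := by
    rcases hεc with ⟨rfl, rfl⟩ | ⟨hc, rfl⟩
    · exact ⟨0, by ring⟩
    · obtain ⟨l, hl, -⟩ := pow_split hc
      exact ⟨2 ^ l, by rw [hl, pow_succ]; ring⟩
  have hkx : Odd (k + x1) := by
    have hE' : Even (m' * (y1 * x2 - k * (x1 + k - y2))) := by
      rw [hE, show (2:ℤ) ^ (h - 1) * (q * (2 * z - 0)) = 2 * (2 ^ (h - 1) * (q * z)) by ring]
      exact even_two_mul _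
    rw [← Int.not_even_iff_odd] at hm ⊢
    simp only [Int.even_sub, Int.even_add, Int.even_mul, Int.not_even_one] at hE' hodd ⊢
    grind
  set P : ℤ := 2 ^ (d - 2) with hP
  set H : ℤ := 2 ^ (h - 1) with hH
  set U : ℤ := m' * o * (k + x1) + 2 * (m' * x1 * o' * P * ρ * (y2 + k)) with hU
  set V : ℤ := q * (εb * (m' * o * (x1 + x2 * (y1 + 1))) - εc * (x1 * o' * (k + 1) * ρ * t')) with hVd
  have hUo : Odd U := ((hm.mul ho).mul hkx).add_even (even_two_mul _)
  have hg2' : o * (g2 - y2) = 2 * P * ρ * (y2 * (y2 - 1)) * o' := by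
    rw [ed] at hg2
    have : 2 * (o * (g2 - y2)) = 2 * (2 * P * ρ * (y2 * (y2 - 1)) * o') := by linarith
    exact mul_left_cancel₀ (by norm_num) this
  have hRk : m' * (2 * P) * k = t' * q * H * (εc + 2 * l) := by
    have : 2 * (m' * (2 * P) * k) = 2 * (t' * q * H * (εc + 2 * l)) := by
      rw [hl, ed, ← e0] at hqq
      linear_combination t' * hqq + 4 * P * hk
    exact mul_left_cancel₀ (by norm_num) this
  have key : (m' * o) * (y1 * x2 + k + (1 - g2) * x1 + H * (εb * q * (x1 + x2 * (y1 + 1)))) =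
      -(U * (y2 - (1 + k + H * μ))) + H * (V - U * μ)
        + (2 * H) * (q * z * o - x1 * o' * (k + 1) * ρ * t' * q * l) := by
    rw [hU, hVd]
    linear_combination o * hE - m' * x1 * hg2' - x1 * o' * ρ * (k + 1) * hRk
  have hVe : Even (V - U * μ) := by
    rw [hVd]
    rw [← Int.not_even_iff_odd] at hm ht hUo hρ ho ho'
    simp only [Int.even_sub, Int.even_add, Int.even_mul, Int.not_even_one] at hV hUo ⊢
    grind
  obtain ⟨v, hv⟩ := hVe
  rw [← odd_dvd h (m' * o) _ (hm.mul ho), ← odd_dvd h U (y2 - _) hUo, key, hv, ← e0]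
  rw [dvd_add_left (Dvd.intro _ rfl), show H * (v + v) = 2 * H * v by ring, dvd_add_left (Dvd.intro _ rfl), dvd_neg]

lemma odd_part (b m : ℕ) (h1 : 2 ^ b ∣ m) (h2 : ¬ 2 ^ (b + 1) ∣ m) :
    ∃ m' : ℤ, (m : ℤ) = 2 ^ b * m' ∧ Odd m' := by
  obtain ⟨w, rfl⟩ := h1
  refine ⟨w, by push_cast; ring, ?_⟩
  rw [← Int.not_even_iff_odd]
  intro hw
  apply h2
  rw [pow_succ]
  apply mul_dvd_mul_left
  rw [even_iff_two_dvd] at hw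
  exact_mod_cast hw

lemma le_of_dvd_odd (a b : ℕ) (o : ℤ) (ho : Odd o) (h : (2:ℤ) ^ a ∣ 2 ^ b * o) : a ≤ b := by
  obtain ⟨z, hz⟩ := h
  exact le_of_odd a b z o hz.symm ho

lemma val_iff (y b d : ℕ) (q : ℤ) (hq : 2 ^ d * (y : ℤ) = 2 ^ b * q) :
    (y ≠ 0 ∧ padicValNat 2 y + d = b) ↔ Odd q := by
  by_cases hy : y = 0
  · subst hy
    have : q = 0 := by
      have h0 : (2:ℤ) ^ b * q = 0 := by rw [← hq]; simp
      rcases mul_eq_zero.1 h0 with h | h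
      · exact absurd h (by positivity)
      · exact h
    simp [this]
  obtain ⟨v, w, hw, hyw⟩ := Nat.exists_eq_two_pow_mul_odd hy
  have hv : padicValNat 2 y = v := by
    have hw0 : w ≠ 0 := by rintro rfl; simp at hw
    rw [hyw, padicValNat.mul (by positivity) hw0, padicValNat.prime_pow,
      padicValNat.eq_zero_of_not_dvd (by rw [← even_iff_two_dvd]; exact Nat.not_even_iff_odd.2 hw)]
    rfl
  have hwz : Odd (w : ℤ) := by exact_mod_cast hw
  rw [hv]
  have h1 : (2:ℤ) ^ (d + v) * w = 2 ^ b * q := by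
    rw [← hq, hyw]; push_cast; ring
  constructor
  · rintro ⟨-, h2⟩
    rw [add_comm d v, h2] at h1
    have : (w : ℤ) = q := mul_left_cancel₀ (by positivity) h1
    rwa [← this]
  · intro hqo
    have := le_of_odd _ _ _ _ h1 hqo
    have := le_of_odd _ _ _ _ h1.symm hwz
    exact ⟨hy, by omega⟩

theorem stmt_17 (n m t r : ℕ) (hn : 0 < n) (hm : 0 < m) (ht : 0 < t) (hr : 0 < r)
    (htn : t ∣ n) (hrm : n ∣ r ^ m - 1) (htr : n ∣ t * (r - 1))
    (h2n : 2 ∣ n)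
    (α₂ β₂ γ₂ δ₂ : ℕ)
    (hα1 : 2 ^ α₂ ∣ n) (hα2 : ¬ 2 ^ (α₂ + 1) ∣ n)
    (hβ1 : 2 ^ β₂ ∣ m) (hβ2 : ¬ 2 ^ (β₂ + 1) ∣ m)
    (hγ1 : 2 ^ γ₂ ∣ t) (hγ2 : ¬ 2 ^ (γ₂ + 1) ∣ t)
    (hδ1 : 2 ^ δ₂ ∣ (r - 1)) (hδ2 : ¬ 2 ^ (δ₂ + 1) ∣ (r - 1))
    (hδ : 1 < δ₂) (hδα : δ₂ < α₂)
    (x₁ x₂ y₁ y₂ : ℕ)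
    (hy : m ∣ Nat.gcd (Nat.gcd (r - 1) n) t * y₁)
    (hodd : ¬ (2 : ℤ) ∣ ((x₁ : ℤ) * (y₂ : ℤ) - (x₂ : ℤ) * (y₁ : ℤ))) :
    (((x₂ : ℤ) * geomS ((r : ℤ) ^ y₂) m + (t : ℤ) * (y₂ : ℤ)
          - (x₁ : ℤ) * geomS ((r : ℤ) ^ y₁) t
          - ((t * y₁ / m : ℕ) : ℤ) * (t : ℤ) ≡ 0 [ZMOD (2 : ℤ) ^ α₂]) ∧
     (((r : ℤ) ^ y₁ - 1) * (x₂ : ℤ)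
          + (geomS ((r : ℤ) ^ y₁) r - (r : ℤ) ^ y₂) * (x₁ : ℤ)
          + (((r - 1) * y₁ / m : ℕ) : ℤ) * (t : ℤ) ≡ 0 [ZMOD (2 : ℤ) ^ α₂])) ↔
    (((m : ℤ) * (x₂ : ℤ)
          ≡ (t : ℤ) * ((x₁ : ℤ) + ((t * y₁ / m : ℕ) : ℤ) - (y₂ : ℤ)) [ZMOD (2 : ℤ) ^ α₂]) ∧
     ((y₂ : ℤ) ≡ 1 + ((t * y₁ / m : ℕ) : ℤ) +
          (if γ₂ ≠ β₂ ∧ min β₂ γ₂ + δ₂ = α₂ ∧ y₁ ≠ 0 ∧ padicValNat 2 y₁ + δ₂ = β₂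
            then (2 : ℤ) ^ (α₂ - δ₂ - 1) else 0)
        [ZMOD (2 : ℤ) ^ (α₂ - δ₂)])) := by
  obtain ⟨Rn, rfl⟩ : ∃ Rn, r = Rn + 1 := ⟨r - 1, by omega⟩
  rw [Nat.add_sub_cancel] at *
  obtain ⟨m', hm', hmo⟩ := odd_part _ _ hβ1 hβ2
  obtain ⟨t', ht', hto⟩ := odd_part _ _ hγ1 hγ2
  obtain ⟨ρ, hρ, hρo⟩ := odd_part _ _ hδ1 hδ2
  obtain ⟨h, hah⟩ : ∃ h, α₂ = h + δ₂ := ⟨α₂ - δ₂, by omega⟩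
  have hh : 1 ≤ h := by omega
  have hd : 2 ≤ δ₂ := hδ
  have hhd : α₂ - δ₂ = h := by omega
  rw [hhd]
  -- exponent inequalities
  have hcd : α₂ ≤ γ₂ + δ₂ := by
    apply le_of_dvd_odd _ _ (t' * ρ) (hto.mul hρo)
    have h1 : ((2 ^ α₂ : ℕ) : ℤ) ∣ ((t * Rn : ℕ) : ℤ) := Int.natCast_dvd_natCast.2 (hα1.trans htr)
    push_cast at h1
    rw [ht', hρ] at h1
    convert h1 using 1
    ring
  have hbd : α₂ ≤ β₂ + δ₂ := by
    obtain ⟨z, hz⟩ := geomS_main (Rn : ℤ) δ₂ hd ⟨ρ, hρ⟩ β₂ m hβ1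
    have hRe : (Rn : ℤ) = 2 * (2 ^ (δ₂ - 1) * ρ) := by
      rw [hρ, ← mul_assoc, ← pow_succ']; congr 2; omega
    have hg : geomS (1 + (Rn : ℤ)) m = 2 ^ β₂ * (m' + m' * (m - 1) * (2 ^ (δ₂ - 1) * ρ) + 2 ^ (2 * δ₂) * z) := by
      have : 2 * geomS (1 + (Rn : ℤ)) m = 2 * (2 ^ β₂ * (m' + m' * (m - 1) * (2 ^ (δ₂ - 1) * ρ) + 2 ^ (2 * δ₂) * z)) := by
        rw [hz]
        have e1 : (2:ℤ) ^ (β₂ + 2 * δ₂ + 1) = 2 * 2 ^ β₂ * 2 ^ (2 * δ₂) := by ring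
        rw [e1]
        linear_combination (2 + (m - 1) * (Rn : ℤ)) * hm' + 2 ^ β₂ * m' * (m - 1) * hRe
      exact mul_left_cancel₀ (by norm_num) this
    have h1 : ((2 ^ α₂ : ℕ) : ℤ) ∣ (((Rn + 1) ^ m - 1 : ℕ) : ℤ) := Int.natCast_dvd_natCast.2 (hα1.trans hrm)
    rw [Nat.cast_sub (Nat.one_le_pow _ _ (by omega))] at h1
    push_cast at h1
    rw [add_comm (Rn : ℤ) 1, pow_eq_geomS, hg, add_sub_cancel_left] at h1
    apply le_of_dvd_odd _ _ (ρ * (m' + m' * (m - 1) * (2 ^ (δ₂ - 1) * ρ) + 2 ^ (2 * δ₂) * z)) ?_ ?_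
    · apply hρo.mul
      rw [add_assoc]
      apply hmo.add_even
      apply Even.add
      · exact ((even_two.pow_of_ne_zero (by omega)).mul_right _).mul_left _
      · exact (even_two.pow_of_ne_zero (by omega)).mul_right _
    · convert h1 using 1
      rw [hρ]
      ring
  -- divisibility of y1
  have hmR : m ∣ Rn * y₁ := hy.trans (mul_dvd_mul_right ((Nat.gcd_dvd_left _ _).trans (Nat.gcd_dvd_left _ _)) _)
  have hmt : m ∣ t * y₁ := hy.trans (mul_dvd_mul_right (Nat.gcd_dvd_right _ _) _)
  obtain ⟨q, hq⟩ : (2:ℤ) ^ β₂ ∣ 2 ^ δ₂ * (y₁ : ℤ) := by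
    rw [← odd_dvd _ ρ _ hρo]
    have h1 : (m : ℤ) ∣ ((Rn * y₁ : ℕ) : ℤ) := Int.natCast_dvd_natCast.2 hmR
    push_cast at h1
    rw [hm', hρ] at h1
    have h2 : (2:ℤ) ^ β₂ ∣ 2 ^ δ₂ * ρ * (y₁ : ℤ) := (Dvd.intro _ rfl).trans h1
    convert h2 using 1
    ring
  obtain ⟨q', hq'⟩ : (2:ℤ) ^ β₂ ∣ 2 ^ γ₂ * (y₁ : ℤ) := by
    rw [← odd_dvd _ t' _ hto]
    have h1 : (m : ℤ) ∣ ((t * y₁ : ℕ) : ℤ) := Int.natCast_dvd_natCast.2 hmt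
    push_cast at h1
    rw [hm', ht'] at h1
    have h2 : (2:ℤ) ^ β₂ ∣ 2 ^ γ₂ * t' * (y₁ : ℤ) := (Dvd.intro _ rfl).trans h1
    convert h2 using 1
    ring
  have hk0 : (m : ℤ) * ((t * y₁ / m : ℕ) : ℤ) = t * y₁ := by
    exact_mod_cast Nat.mul_div_cancel' hmt
  have hk1 : (m : ℤ) * ((Rn * y₁ / m : ℕ) : ℤ) = Rn * y₁ := by
    exact_mod_cast Nat.mul_div_cancel' hmR
  generalize ((t * y₁ / m : ℕ) : ℤ) = k at *
  generalize ((Rn * y₁ / m : ℕ) : ℤ) = k' at *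
  have hmz : (m : ℤ) ≠ 0 := by exact_mod_cast hm.ne'
  have hk't : k' * t = Rn * k := by
    apply mul_left_cancel₀ hmz
    linear_combination t * hk1 - Rn * hk0
  have hk : m' * k = t' * q' := by
    have : (2:ℤ) ^ β₂ * (m' * k) = 2 ^ β₂ * (t' * q') := by
      rw [hm', ht'] at hk0
      linear_combination hk0 + t' * hq'
    exact mul_left_cancel₀ (by positivity) this
  -- indicator variables
  obtain ⟨εb, hεb⟩ : ∃ ε : ℤ, (β₂ = h ∧ ε = 1) ∨ (h < β₂ ∧ ε = 0) := by
    rcases (show h ≤ β₂ by omega).eq_or_lt with h1 | h1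
    · exact ⟨1, Or.inl ⟨h1.symm, rfl⟩⟩
    · exact ⟨0, Or.inr ⟨h1, rfl⟩⟩
  obtain ⟨εc, hεc⟩ : ∃ ε : ℤ, (γ₂ = h ∧ ε = 1) ∨ (h < γ₂ ∧ ε = 0) := by
    rcases (show h ≤ γ₂ by omega).eq_or_lt with h1 | h1
    · exact ⟨1, Or.inl ⟨h1.symm, rfl⟩⟩
    · exact ⟨0, Or.inr ⟨h1, rfl⟩⟩
  obtain ⟨μ, hμ, hif⟩ : ∃ μ : ℤ,
      ((β₂ ≠ γ₂ ∧ min β₂ γ₂ = h ∧ Odd q ∧ μ = 1) ∨ (¬ (β₂ ≠ γ₂ ∧ min β₂ γ₂ = h ∧ Odd q) ∧ μ = 0)) ∧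
      (if γ₂ ≠ β₂ ∧ min β₂ γ₂ + δ₂ = α₂ ∧ y₁ ≠ 0 ∧ padicValNat 2 y₁ + δ₂ = β₂
            then (2 : ℤ) ^ (h - 1) else 0) = 2 ^ (h - 1) * μ := by
    have hv := val_iff y₁ β₂ δ₂ q hq
    have hiff : (γ₂ ≠ β₂ ∧ min β₂ γ₂ + δ₂ = α₂ ∧ y₁ ≠ 0 ∧ padicValNat 2 y₁ + δ₂ = β₂) ↔
        (β₂ ≠ γ₂ ∧ min β₂ γ₂ = h ∧ Odd q) := by
      rw [hv, ne_comm, show min β₂ γ₂ + δ₂ = α₂ ↔ min β₂ γ₂ = h by omega]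
    by_cases hc : (β₂ ≠ γ₂ ∧ min β₂ γ₂ = h ∧ Odd q)
    · exact ⟨1, Or.inl ⟨hc.1, hc.2.1, hc.2.2, rfl⟩, by rw [if_pos (hiff.2 hc)]; ring⟩
    · exact ⟨0, Or.inr ⟨hc, rfl⟩, by rw [if_neg (fun hx => hc (hiff.1 hx))]; ring⟩
  rw [hif]
  have hodd' : ¬ Even ((x₁ : ℤ) * y₂ - x₂ * y₁) := by rwa [even_iff_two_dvd]
  -- the two congruences
  obtain ⟨z1, hz1⟩ := cong_one Rn δ₂ hd ρ hρ hρo α₂ β₂ m m' hm' hmo hδα εb (by omega) y₂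
  obtain ⟨z2, hz2⟩ := cong_one Rn δ₂ hd ρ hρ hρo α₂ γ₂ t t' ht' hto hδα εc (by omega) y₁
  obtain ⟨o, o', ho, ho', hg2⟩ := geomS_exact Rn δ₂ hd ρ hρ hρo y₂
  have hg2e : Even (geomS (1 + (Rn : ℤ)) y₂ - y₂) := by
    have hRe : (2:ℤ) ∣ Rn := by rw [hρ]; exact (dvd_pow_self 2 (by omega)).mul_right _
    exact even_iff_two_dvd.2 (hRe.trans (geomS_base1 _ _))
  have hc2 := cong_two Rn δ₂ hd ρ hρ hρo α₂ β₂ h hah hh εb hεb y₁ y₂ q x₁ x₂ k hq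
  have hcast : (((Rn + 1 : ℕ)) : ℤ) = 1 + (Rn : ℤ) := by push_cast; ring
  rw [hcast, hk't, Int.modEq_zero_iff_dvd, Int.modEq_zero_iff_dvd, hc2,
    Int.modEq_iff_dvd, Int.modEq_iff_dvd, hz1, hz2]
  have hC1 : (x₂ : ℤ) * (m + 2 ^ (α₂ - 1) * (εb * y₂) + 2 ^ α₂ * z1) + t * y₂
      - x₁ * (t + 2 ^ (α₂ - 1) * (εc * y₁) + 2 ^ α₂ * z2) - k * t =
      (2 ^ β₂ * m' * x₂ - 2 ^ γ₂ * t' * (x₁ + k - y₂)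
      + 2 ^ (α₂ - 1) * (εb * (x₂ * y₂) - εc * (x₁ * y₁))) + 2 ^ α₂ * (x₂ * z1 - x₁ * z2) := by
    rw [hm', ht']; ring
  have hD1 : (t : ℤ) * (x₁ + k - y₂) - m * x₂ = -(2 ^ β₂ * m' * x₂ - 2 ^ γ₂ * t' * (x₁ + k - y₂)) := by
    rw [hm', ht']; ring
  rw [hC1, dvd_add_left (Dvd.intro _ rfl), hD1, dvd_neg,
    dvd_sub_comm (b := 1 + k + 2 ^ (h - 1) * μ)]
  have hg2 : o * (2 * (geomS (1 + (Rn : ℤ)) y₂ - y₂)) = (2 ^ δ₂ * ρ) * (y₂ * (y₂ - 1)) * o' := by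
    rw [← hρ]; exact hg2
  have e0 : (2:ℤ) ^ α₂ = 2 ^ (α₂ - 1) * 2 := by
    rw [← pow_succ]; congr 1; omega
  have hDQ : Even ((y₂ : ℤ) - 1 - k) →
      (2:ℤ) ^ (h + 1) ∣ 2 ^ β₂ * m' * x₂ - 2 ^ γ₂ * t' * (x₁ + k - y₂) →
      ((2:ℤ) ^ α₂ ∣ 2 ^ β₂ * m' * x₂ - 2 ^ γ₂ * t' * (x₁ + k - y₂)
      + 2 ^ (α₂ - 1) * (εb * (x₂ * y₂) - εc * (x₁ * y₁)) ↔
      (2:ℤ) ^ α₂ ∣ 2 ^ β₂ * m' * x₂ - 2 ^ γ₂ * t' * (x₁ + k - y₂)) := by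
    intro hw hD
    have hQ := Q_even β₂ γ₂ δ₂ h m' t' x₁ x₂ y₁ y₂ k q q' εb εc hmo hto hεb hεc hq' hk hodd' hD hw
    apply dvd_add_left
    rw [e0]
    exact mul_dvd_mul_left _ (even_iff_two_dvd.1 hQ)
  constructor
  · rintro ⟨h1, h2⟩
    have hw := w_even α₂ β₂ γ₂ δ₂ h hah hh hd m' t' x₁ x₂ y₁ y₂ k q q' εb εc _ hmo hεb hεc hq hq' hk
      hodd' hg2e h1 h2
    have hD : (2:ℤ) ^ (h + 1) ∣ 2 ^ β₂ * m' * x₂ - 2 ^ γ₂ * t' * (x₁ + k - y₂) := by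
      have h3 := (pow_dvd_pow (2:ℤ) (show h + 1 ≤ α₂ by omega)).trans h1
      rwa [dvd_add_left (Dvd.dvd.mul_right (pow_dvd_pow _ (by omega)) _)] at h3
    have hD1 := (hDQ hw hD).1 h1
    exact ⟨hD1, (fin α₂ β₂ γ₂ δ₂ h hah hh hd ρ m' t' x₁ x₂ y₁ y₂ k q q' εb εc μ _ o o' hρo hmo hto
      hεb hεc hμ hq hq' hk hodd' ho ho' hg2 hD1 hw).1 h2⟩
  · rintro ⟨h1, h2⟩
    have hw : Even ((y₂ : ℤ) - 1 - k) := by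
      have h3 := (dvd_pow_self (2:ℤ) (show h ≠ 0 by omega)).trans h2
      have h4 : Even (2 ^ (h - 1) * μ) := by
        rcases hμ with ⟨h5, h6, h7, -⟩ | ⟨-, h5⟩
        · have hqq : (2:ℤ) ^ δ₂ * q' = 2 ^ γ₂ * q := by
            have : (2:ℤ) ^ β₂ * (2 ^ δ₂ * q') = 2 ^ β₂ * (2 ^ γ₂ * q) := by
              linear_combination 2 ^ γ₂ * hq - 2 ^ δ₂ * hq'
            exact mul_left_cancel₀ (by positivity) this
          have hdc := le_of_odd _ _ _ _ hqq h7
          have hdb := le_of_odd _ _ _ _ hq h7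
          exact (even_two.pow_of_ne_zero (by omega)).mul_right _
        · simp [h5]
      rw [← even_iff_two_dvd] at h3
      have : (y₂ : ℤ) - 1 - k = (y₂ - (1 + k + 2 ^ (h - 1) * μ)) + 2 ^ (h - 1) * μ := by ring
      rw [this]
      exact h3.add h4
    have hD : (2:ℤ) ^ (h + 1) ∣ 2 ^ β₂ * m' * x₂ - 2 ^ γ₂ * t' * (x₁ + k - y₂) :=
      (pow_dvd_pow (2:ℤ) (show h + 1 ≤ α₂ by omega)).trans h1
    exact ⟨(hDQ hw hD).2 h1, (fin α₂ β₂ γ₂ δ₂ h hah hh hd ρ m' t' x₁ x₂ y₁ y₂ k q q' εb εc μ _ o o' hρo hmo hto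
      hεb hεc hμ hq hq' hk hodd' ho ho' hg2 h1 hw).2 h2⟩
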